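/- There is no 4-way latin square of order 7 with exactly 20 fixed cells, i.e., 20 ∉ I⁴[7]. -/

import Mathlib

/-- A μ-way latin square of order n: μ latin squares on symbols `Fin n` such that
in every cell the μ entries are all equal or pairwise distinct. -/
def IsMuWayLatinSquare {μ n : ℕ} (L : Fin μ → Fin n → Fin n → Fin n) : Prop :=
  (∀ m i, Function.Injective (L m i)) ∧
  (∀ m j, Function.Injective (fun i => L m i j)) ∧
  (∀ i j, (∀ a b, L a i j = L b i j) ∨ Function.Injective (fun a => L a i j))

/-- A cell is fixed when the μ entries there coincide. -/
def IsFixedCell {μ n : ℕ} (L : Fin μ → Fin n → Fin n → Fin n) (i j : Fin n) : Prop :=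
  ∀ a b, L a i j = L b i j

instance {μ n : ℕ} (L : Fin μ → Fin n → Fin n → Fin n) (i j : Fin n) :
    Decidable (IsFixedCell L i j) :=
  inferInstanceAs (Decidable (∀ a b, L a i j = L b i j))

/-- The number of fixed cells. -/
def numFixed {μ n : ℕ} (L : Fin μ → Fin n → Fin n → Fin n) : ℕ :=
  (Finset.univ.filter fun p : Fin n × Fin n => IsFixedCell L p.1 p.2).card

/-- The number of fixed cells in row `i`. -/
def rowFixed {μ n : ℕ} (L : Fin μ → Fin n → Fin n → Fin n) (i : Fin n) : ℕ :=
  (Finset.univ.filter fun j : Fin n => IsFixedCell L i j).card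

/-- The intersection spectrum `I^μ[n]`. -/
def Spectrum (μ n : ℕ) : Set ℕ :=
  {k | ∃ L : Fin μ → Fin n → Fin n → Fin n, IsMuWayLatinSquare L ∧ numFixed L = k}

section MuWayLatinSquare

variable {μ n : ℕ} {L : Fin μ → Fin n → Fin n → Fin n}

theorem IsMuWayLatinSquare.transpose (h : IsMuWayLatinSquare L) :
    IsMuWayLatinSquare fun m i j => L m j i :=
  ⟨h.2.1, h.1, fun i j => h.2.2 j i⟩

theorem sum_rowFixed (L : Fin μ → Fin n → Fin n → Fin n) :
    ∑ i, rowFixed L i = numFixed L := by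
  simp only [rowFixed, numFixed, Finset.card_filter, Fintype.sum_prod_type]

theorem numFixed_transpose (L : Fin μ → Fin n → Fin n → Fin n) :
    numFixed (fun m i j => L m j i) = numFixed L := by
  simp only [numFixed, Finset.card_filter, Fintype.sum_prod_type]
  exact Finset.sum_comm

/-- The columns of the fixed cells of row `i`. -/
def fixedCols (L : Fin μ → Fin n → Fin n → Fin n) (i : Fin n) : Finset (Fin n) :=
  {j | IsFixedCell L i j}

/-- The symbols of the fixed cells of row `i`. -/
def fixedSymbols (L : Fin μ → Fin n → Fin n → Fin n) (i : Fin n) : Finset (Fin n) :=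
  Finset.univ.filter fun s => ∃ j, ∀ a, L a i j = s

/-- The symbols occurring in the cell `(i, j)`. -/
def cellSymbols (L : Fin μ → Fin n → Fin n → Fin n) (i j : Fin n) : Finset (Fin n) :=
  Finset.univ.image fun a => L a i j

theorem mem_fixedCols {i j : Fin n} : j ∈ fixedCols L i ↔ IsFixedCell L i j := by
  simp [fixedCols]

theorem mem_fixedSymbols {i s : Fin n} : s ∈ fixedSymbols L i ↔ ∃ j, ∀ a, L a i j = s := by
  simp [fixedSymbols]

theorem card_fixedCols (L : Fin μ → Fin n → Fin n → Fin n) (i : Fin n) :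
    (fixedCols L i).card = rowFixed L i := rfl

theorem IsMuWayLatinSquare.card_fixedSymbols [NeZero μ] (h : IsMuWayLatinSquare L) (i : Fin n) :
    (fixedSymbols L i).card = rowFixed L i := by
  have himage : fixedSymbols L i = (fixedCols L i).image (L 0 i) := by
    ext s
    simp only [mem_fixedSymbols, Finset.mem_image, mem_fixedCols]
    constructor
    · rintro ⟨j, hj⟩
      exact ⟨j, fun a b => (hj a).trans (hj b).symm, hj 0⟩
    · rintro ⟨j, hj, rfl⟩
      exact ⟨j, fun a => hj a 0⟩
  rw [himage, Finset.card_image_of_injective _ (h.1 0 i), card_fixedCols]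

theorem IsMuWayLatinSquare.card_cellSymbols (h : IsMuWayLatinSquare L) {i j : Fin n}
    (hij : ¬ IsFixedCell L i j) : (cellSymbols L i j).card = μ := by
  rw [cellSymbols, Finset.card_image_of_injective _ ((h.2.2 i j).resolve_left hij),
    Finset.card_univ, Fintype.card_fin]

theorem IsMuWayLatinSquare.disjoint_cellSymbols (h : IsMuWayLatinSquare L) {i j : Fin n}
    (hij : ¬ IsFixedCell L i j) : Disjoint (fixedSymbols L i) (cellSymbols L i j) := by
  rw [Finset.disjoint_left]
  intro s hs hs'
  obtain ⟨k, hk⟩ := mem_fixedSymbols.1 hs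
  obtain ⟨a, -, ha⟩ := Finset.mem_image.1 hs'
  obtain rfl := h.1 a i (ha.trans (hk a).symm)
  exact hij fun b c => (hk b).trans (hk c).symm

theorem IsMuWayLatinSquare.rowFixed_add_le [NeZero μ] (h : IsMuWayLatinSquare L) {i j : Fin n}
    (hij : ¬ IsFixedCell L i j) : rowFixed L i + μ ≤ n := by
  have hcard := Finset.card_le_univ (fixedSymbols L i ∪ cellSymbols L i j)
  rwa [Finset.card_union_of_disjoint (h.disjoint_cellSymbols hij), h.card_fixedSymbols,
    h.card_cellSymbols hij, Fintype.card_fin] at hcard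

theorem IsMuWayLatinSquare.cellSymbols_eq [NeZero μ] (h : IsMuWayLatinSquare L) {i j : Fin n}
    (hij : ¬ IsFixedCell L i j) (hi : rowFixed L i + μ = n) :
    cellSymbols L i j = (fixedSymbols L i)ᶜ := by
  refine Finset.eq_of_subset_of_card_le ?_ ?_
  · exact Finset.subset_compl_iff_disjoint_left.2 (h.disjoint_cellSymbols hij)
  · rw [Finset.card_compl, h.card_fixedSymbols, h.card_cellSymbols hij, Fintype.card_fin]
    omega

theorem rowFixed_eq_iff {i : Fin n} : rowFixed L i = n ↔ ∀ j, IsFixedCell L i j := by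
  simpa [rowFixed] using
    Finset.card_filter_eq_iff (s := Finset.univ) (p := fun j : Fin n => IsFixedCell L i j)

/-- Double counting of the cells in the fully fixed rows and the non-fixed columns of row `i`. -/
theorem IsMuWayLatinSquare.full_rows_mul_le [NeZero μ] (h : IsMuWayLatinSquare L) (i : Fin n) :
    (Finset.univ.filter fun r => rowFixed L r = n).card * (n - rowFixed L i) ≤
      (Finset.univ.filter fun r => rowFixed L r = n).card * rowFixed L i +
        (n - rowFixed L i) * (n - rowFixed L i - μ) := by
  set R : Finset (Fin n) := Finset.univ.filter fun r => rowFixed L r = n with hR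
  have hcompl : (fixedCols L i)ᶜ.card = n - rowFixed L i := by
    rw [Finset.card_compl, card_fixedCols, Fintype.card_fin]
  have hcol : ∀ j ∈ (fixedCols L i)ᶜ,
      R.card ≤ (R.filter fun r => L 0 r j ∈ fixedSymbols L i).card + (n - rowFixed L i - μ) := by
    intro j hj
    rw [Finset.mem_compl, mem_fixedCols] at hj
    rw [← Finset.card_filter_add_card_filter_not (s := R) (fun r => L 0 r j ∈ fixedSymbols L i)]
    gcongr
    calc (R.filter fun r => L 0 r j ∉ fixedSymbols L i).card
        = ((R.filter fun r => L 0 r j ∉ fixedSymbols L i).image fun r => L 0 r j).card :=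
          (Finset.card_image_of_injective _ (h.2.1 0 j)).symm
      _ ≤ (fixedSymbols L i ∪ cellSymbols L i j)ᶜ.card := by
          refine Finset.card_le_card fun s hs => ?_
          obtain ⟨r, hr, rfl⟩ := Finset.mem_image.1 hs
          rw [Finset.mem_filter, hR, Finset.mem_filter_univ, rowFixed_eq_iff] at hr
          rw [Finset.mem_compl, Finset.mem_union, not_or]
          refine ⟨hr.2, fun hmem => ?_⟩
          obtain ⟨a, -, ha⟩ := Finset.mem_image.1 hmem
          obtain rfl := h.2.1 a j (ha.trans (hr.1 j 0 a))
          exact hj (hr.1 j)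
      _ = n - rowFixed L i - μ := by
          rw [Finset.card_compl, Finset.card_union_of_disjoint (h.disjoint_cellSymbols hj),
            h.card_fixedSymbols, h.card_cellSymbols hj, Fintype.card_fin, Nat.sub_sub]
  have hrow : ∀ r ∈ R,
      ((fixedCols L i)ᶜ.filter fun j => L 0 r j ∈ fixedSymbols L i).card ≤ rowFixed L i := by
    intro r _
    rw [← h.card_fixedSymbols, ← Finset.card_image_of_injective _ (h.1 0 r)]
    refine Finset.card_le_card fun s hs => ?_
    obtain ⟨j, hj, rfl⟩ := Finset.mem_image.1 hs
    exact (Finset.mem_filter.1 hj).2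
  have hswap : ∑ j ∈ (fixedCols L i)ᶜ, (R.filter fun r => L 0 r j ∈ fixedSymbols L i).card =
      ∑ r ∈ R, ((fixedCols L i)ᶜ.filter fun j => L 0 r j ∈ fixedSymbols L i).card := by
    simp only [Finset.card_filter]
    exact Finset.sum_comm
  have hsum := Finset.sum_le_sum hcol
  rw [Finset.sum_add_distrib, hswap, Finset.sum_const, Finset.sum_const, hcompl, smul_eq_mul,
    smul_eq_mul, mul_comm] at hsum
  have hle := Finset.sum_le_sum hrow
  rw [Finset.sum_const, smul_eq_mul] at hle
  omega

/-- If all rows but one have the same set of fixed symbols, those symbols are fixed in the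
remaining row as well. -/
theorem IsMuWayLatinSquare.fixedSymbols_subset [NeZero μ] (h : IsMuWayLatinSquare L)
    {i₀ : Fin n} {T : Finset (Fin n)} (hT : ∀ i, i ≠ i₀ → fixedSymbols L i = T) :
    T ⊆ fixedSymbols L i₀ := by
  intro t ht
  obtain ⟨j, hj⟩ := Finite.injective_iff_surjective.1 (h.1 0 i₀) t
  refine mem_fixedSymbols.2 ⟨j, fun m => ?_⟩
  obtain ⟨j', hj'⟩ := Finite.injective_iff_surjective.1 (h.1 m i₀) t
  obtain ⟨i', hi'⟩ := Finite.injective_iff_surjective.1 (h.2.1 0 j') t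
  by_cases hi : i' = i₀
  · subst hi
    rwa [h.1 0 i' (hj.trans hi'.symm)]
  · rw [← hT i' hi] at ht
    obtain ⟨k, hk⟩ := mem_fixedSymbols.1 ht
    obtain rfl := h.1 0 i' (hi'.trans (hk 0).symm)
    exact absurd (h.2.1 m j' ((hk m).trans hj'.symm)) hi

end MuWayLatinSquare

/-- The only row sequence of a 4-way latin square of order 7 with 20 fixed cells is
`2, 3, 3, 3, 3, 3, 3`, up to order. -/
theorem exists_rowFixed_eq_two {L : Fin 4 → Fin 7 → Fin 7 → Fin 7} (h : IsMuWayLatinSquare L)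
    (h20 : numFixed L = 20) :
    ∃ i₀, rowFixed L i₀ = 2 ∧ ∀ i, i ≠ i₀ → rowFixed L i = 3 := by
  have hsum : ∑ i, rowFixed L i = 20 := (sum_rowFixed L).trans h20
  have hle : ∀ i, rowFixed L i ≠ 7 → rowFixed L i ≤ 3 := by
    intro i hi
    rw [Ne, rowFixed_eq_iff, not_forall] at hi
    obtain ⟨j, hj⟩ := hi
    have := h.rowFixed_add_le hj
    omega
  have hfull := h.full_rows_mul_le
  set r := (Finset.univ.filter fun i => rowFixed L i = 7).card with hr
  have hbound : ∀ c, c ≤ 7 → (∀ i, rowFixed L i ≠ 7 → rowFixed L i ≤ c) →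
      20 ≤ 7 * c + r * (7 - c) := by
    intro c hc hi
    calc 20 = ∑ i, rowFixed L i := hsum.symm
      _ ≤ ∑ i, (c + if rowFixed L i = 7 then 7 - c else 0) := by
          refine Finset.sum_le_sum fun i _ => ?_
          have := hi i
          split_ifs <;> omega
      _ = 7 * c + r * (7 - c) := by
          rw [Finset.sum_add_distrib, ← Finset.sum_filter, Finset.sum_const, Finset.sum_const,
            ← hr, Finset.card_univ, Fintype.card_fin, smul_eq_mul, smul_eq_mul]
  have hr2 : r * 7 ≤ 20 := by
    rw [← hsum, hr, ← smul_eq_mul, ← Finset.sum_const, Finset.sum_filter]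
    refine Finset.sum_le_sum fun i _ => ?_
    split_ifs <;> omega
  have hr0 : r = 0 := by
    by_contra hne
    have hr12 : r = 1 ∨ r = 2 := by omega
    have hc : ∀ i, rowFixed L i ≠ 7 → rowFixed L i ≤ 3 - r := by
      intro i hi
      have h3 := hle i hi
      have hi' := hfull i
      generalize rowFixed L i = f at h3 hi'
      rcases hr12 with h1 | h1 <;> rw [h1] at hi' ⊢ <;> interval_cases f <;> omega
    have := hbound (3 - r) (by omega) hc
    rcases hr12 with h1 | h1 <;> rw [h1] at this <;> omega
  have hle3 : ∀ i, rowFixed L i ≤ 3 := by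
    intro i
    refine hle i fun hi => ?_
    have hi' : i ∈ Finset.univ.filter fun i => rowFixed L i = 7 := by simpa using hi
    rw [Finset.card_eq_zero.1 (hr.symm.trans hr0)] at hi'
    simp at hi'
  have hdef : ∑ i, (3 - rowFixed L i) = 1 := by
    have hadd : ∑ i, (3 - rowFixed L i) + ∑ i, rowFixed L i = ∑ _i : Fin 7, 3 := by
      rw [← Finset.sum_add_distrib]
      exact Finset.sum_congr rfl fun i _ => Nat.sub_add_cancel (hle3 i)
    rw [hsum, Finset.sum_const, Finset.card_univ, Fintype.card_fin, smul_eq_mul] at hadd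
    omega
  obtain ⟨i₀, -, h₀⟩ := Finset.exists_ne_zero_of_sum_ne_zero (hdef.trans_ne one_ne_zero)
  rw [← Finset.add_sum_erase _ _ (Finset.mem_univ i₀)] at hdef
  refine ⟨i₀, by omega, fun i hi => ?_⟩
  have hzero : ∑ i ∈ Finset.univ.erase i₀, (3 - rowFixed L i) = 0 := by omega
  have := Finset.sum_eq_zero_iff.1 hzero i (Finset.mem_erase.2 ⟨hi, Finset.mem_univ i⟩)
  have := hle3 i
  omega

theorem stmt_15 : (20 : ℕ) ∉ Spectrum 4 7 := by
  rintro ⟨L, h, h20⟩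
  obtain ⟨i₀, hi₀, hrow⟩ := exists_rowFixed_eq_two h h20
  obtain ⟨j₀, hj₀, hcol⟩ :=
    exists_rowFixed_eq_two h.transpose ((numFixed_transpose L).trans h20)
  obtain ⟨i₁, hi₁, hne⟩ : ∃ i ∈ fixedCols (fun m i j => L m j i) j₀, i ≠ i₀ :=
    Finset.exists_mem_ne (by rw [card_fixedCols, hj₀]; norm_num) i₀
  rw [mem_fixedCols] at hi₁
  have hsame : ∀ i, i ≠ i₀ → fixedSymbols L i = fixedSymbols L i₁ := by
    intro i hi
    obtain ⟨j, hj⟩ : ∃ j, j ∉ fixedCols L i ∪ fixedCols L i₁ := by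
      by_contra! hall
      have huniv := Finset.card_union_le (fixedCols L i) (fixedCols L i₁)
      rw [Finset.eq_univ_iff_forall.2 hall, Finset.card_univ, Fintype.card_fin, card_fixedCols,
        card_fixedCols, hrow i hi, hrow i₁ hne] at huniv
      omega
    rw [Finset.mem_union, not_or, mem_fixedCols, mem_fixedCols] at hj
    have hjne : j ≠ j₀ := by
      rintro rfl
      exact hj.2 hi₁
    have hcell : cellSymbols L i j = cellSymbols L i₁ j :=
      (h.transpose.cellSymbols_eq (i := j) (j := i) hj.1 (by rw [hcol j hjne])).trans
        (h.transpose.cellSymbols_eq (i := j) (j := i₁) hj.2 (by rw [hcol j hjne])).symm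
    rw [h.cellSymbols_eq hj.1 (by rw [hrow i hi]),
      h.cellSymbols_eq hj.2 (by rw [hrow i₁ hne])] at hcell
    exact compl_injective hcell
  have hcard := Finset.card_le_card (h.fixedSymbols_subset hsame)
  rw [h.card_fixedSymbols, h.card_fixedSymbols, hi₀, hrow i₁ hne] at hcard
  omega
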